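/- arXiv:1901.10973 — 4 statements merged into one kernel-verified Lean document; each statement's English description precedes it below -/
import Mathlib

section
/- Let M > 0 and let r : [0,∞) → ℝ be a continuous function with r(s) > 2M for all s ≥ 0. Let f, h : ℝ → ℝ be C¹ functions such that H := f + h satisfies H(1) = 0, H(−1) = 0, H'(1) ≠ 0 and H'(−1) ≠ 0. If u : [0,∞) → ℝ is differentiable and satisfies the characteristic ODE u'(s) = (2M/(r(s) − 2M)²)·(f(u(s)) + h(u(s))) for all s ≥ 0, and |u(0)| ≤ 1, then |u(s)| ≤ 1 for all s ≥ 0. -/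
theorem stay_aux (H k u : ℝ → ℝ) (a b c : ℝ) (hab : a ≤ b) (hH : ContDiff ℝ 1 H) (hc : H c = 0)
    (hk : ContinuousOn k (Set.Icc a b))
    (hu : ∀ s ∈ Set.Icc a b, HasDerivAt u (k s * H (u s)) s) (hua : u a = c) : u b = c := by
  have huc : ContinuousOn u (Set.Icc a b) := fun s hs => (hu s hs).continuousAt.continuousWithinAt
  obtain ⟨K, hK⟩ := isCompact_Icc.exists_bound_of_continuousOn hk
  obtain ⟨R, hR⟩ := isCompact_Icc.exists_bound_of_continuousOn huc
  obtain ⟨L, hL⟩ := (isCompact_closedBall (0:ℝ) R).exists_bound_of_continuousOn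
    (hH.continuous_deriv le_rfl).continuousOn
  have ha : a ∈ Set.Icc a b := ⟨le_rfl, hab⟩
  have hv : ∀ t ∈ Set.Ico a b, LipschitzOnWith (K * L).toNNReal (fun x => k t * H x)
      (Metric.closedBall (0:ℝ) R) := by
    intro t ht
    apply (convex_closedBall (0:ℝ) R).lipschitzOnWith_of_nnnorm_deriv_le
    · intro x hx
      exact ((hH.differentiable one_ne_zero) x).const_mul _
    · intro x hx
      rw [← NNReal.coe_le_coe, coe_nnnorm, deriv_const_mul _ ((hH.differentiable one_ne_zero) x),
        norm_mul]
      refine le_trans ?_ (Real.le_coe_toNNReal _)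
      have h1 := hK t ⟨ht.1, ht.2.le⟩
      exact mul_le_mul h1 (hL x hx) (norm_nonneg _) ((norm_nonneg _).trans h1)
  have key := ODE_solution_unique_of_mem_Icc_right (v := fun t x => k t * H x)
    (s := fun _ => Metric.closedBall (0:ℝ) R) (f := u) (g := fun _ => c) hv huc
    (fun t ht => (hu t ⟨ht.1, ht.2.le⟩).hasDerivWithinAt)
    (fun t ht => by simpa using hR t ⟨ht.1, ht.2.le⟩) continuousOn_const
    (fun t ht => by simpa [hc] using hasDerivWithinAt_const t (Set.Ici t) c)
    (fun t ht => by simpa [hua] using hR a ha) hua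
  exact key ⟨hab, le_rfl⟩

/-- Maximum principle along characteristics for the hyperbolic balance law on a
Schwarzschild background of mass `M > 0`. -/
theorem stmt_0 (M : ℝ) (hM : 0 < M) (r : ℝ → ℝ)
    (hr_cont : ContinuousOn r (Set.Ici (0:ℝ)))
    (hr : ∀ s ∈ Set.Ici (0:ℝ), 2 * M < r s)
    (f h : ℝ → ℝ) (hf : ContDiff ℝ 1 f) (hh : ContDiff ℝ 1 h)
    (hH1 : f 1 + h 1 = 0) (hHm1 : f (-1) + h (-1) = 0)
    (hH'1 : deriv f 1 + deriv h 1 ≠ 0) (hH'm1 : deriv f (-1) + deriv h (-1) ≠ 0)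
    (u : ℝ → ℝ)
    (hu : ∀ s ∈ Set.Ici (0:ℝ),
      HasDerivAt u (2 * M / (r s - 2 * M) ^ 2 * (f (u s) + h (u s))) s)
    (hu0 : |u 0| ≤ 1) :
    ∀ s ∈ Set.Ici (0:ℝ), |u s| ≤ 1 := by
  intro b hb
  have hb0 : (0:ℝ) ≤ b := hb
  have huc : ContinuousOn u (Set.Icc 0 b) :=
    fun s hs => (hu s hs.1).continuousAt.continuousWithinAt
  have hk : ContinuousOn (fun s => 2 * M / (r s - 2 * M) ^ 2) (Set.Ici 0) := by
    apply ContinuousOn.div continuousOn_const ((hr_cont.sub continuousOn_const).pow 2)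
    intro s hs
    have := hr s hs
    exact pow_ne_zero 2 (sub_pos.2 this).ne'
  have stay : ∀ c, f c + h c = 0 → c ∈ u '' Set.Icc 0 b → u b = c := by
    rintro c hc ⟨a, ha, hac⟩
    exact stay_aux (fun x => f x + h x) _ u a b c ha.2 (hf.add hh) hc
      (hk.mono fun s hs => ha.1.trans hs.1) (fun s hs => hu s (ha.1.trans hs.1)) hac
  rw [abs_le] at hu0 ⊢
  constructor
  · by_contra! hlt
    have := stay (-1) hHm1 (intermediate_value_Icc' hb0 huc ⟨hlt.le, hu0.1⟩)
    linarith
  · by_contra! hlt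
    have := stay 1 hH1 (intermediate_value_Icc hb0 huc ⟨hu0.2, hlt.le⟩)
    linarith
end

section
/- Let M > 0 and let R, û : I → ℝ be differentiable functions on an interval I ⊆ ℝ with R(s) > 2M for all s ∈ I, satisfying the characteristic system dR/ds = (1 − 2M/R(s))·û(s) and dû/ds = (M/R(s)²)·(û(s)² − 1). Then the quantity s ↦ (1 − û(s)²)/(1 − 2M/R(s)) is constant on I; equivalently (1 − û(s)²)/(1 − 2M/R(s)) = (1 − û(s₀)²)/(1 − 2M/R(s₀)) for any s₀, s ∈ I. -/
/-- Along the characteristic curves of the Burgers-type equation on a Schwarzschild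
background, the quantity `(1 - û²)/(1 - 2M/R)` is conserved. -/
theorem stmt_2 (M : ℝ) (hM : 0 < M) (I : Set ℝ) (hI : I.OrdConnected)
    (R u : ℝ → ℝ) (hR : ∀ s ∈ I, 2 * M < R s)
    (hR' : ∀ s ∈ I, HasDerivAt R ((1 - 2 * M / R s) * u s) s)
    (hu' : ∀ s ∈ I, HasDerivAt u (M / (R s) ^ 2 * ((u s) ^ 2 - 1)) s) :
    ∀ s₀ ∈ I, ∀ s ∈ I,
      (1 - (u s) ^ 2) / (1 - 2 * M / R s) = (1 - (u s₀) ^ 2) / (1 - 2 * M / R s₀) := by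
  intro s₀ h₀ s hs
  have key : ∀ t ∈ I, HasDerivWithinAt
      (fun t => (1 - (u t) ^ 2) / (1 - 2 * M / R t)) 0 I t := by
    intro t ht
    have hRt := hR t ht
    have hpos : 0 < R t := by linarith
    have hne : R t ≠ 0 := hpos.ne'
    have hlt : 2 * M / R t < 1 := by rw [div_lt_one hpos]; exact hRt
    have hd : 1 - 2 * M / R t ≠ 0 := by linarith
    have h1 := ((hu' t ht).pow 2).const_sub 1
    have h2 := ((hasDerivAt_const t (2 * M)).div (hR' t ht) hne).const_sub 1
    have h3 := (h1.div h2 hd).hasDerivWithinAt (s := I)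
    refine h3.congr_deriv ?_
    rw [div_eq_zero_iff]
    left
    simp only [Pi.pow_apply, Pi.div_apply]
    push_cast
    field_simp
    ring
  have h := hI.convex.norm_image_sub_le_of_norm_hasDerivWithin_le (C := 0) key
    (by simp) h₀ hs
  rw [zero_mul] at h
  exact sub_eq_zero.mp (norm_le_zero_iff.mp h)
end

section
/- Let ι be a finite index set, let A, B ∈ ℝ and A_e ∈ ℝ for e ∈ ι satisfy: A_e ≥ 0 for all e, A + Σ_{e∈ι} A_e = 1, A ≥ 1/2, and B ≥ 0. Let f, h : ℝ → ℝ be C¹ functions with f(1) + h(1) = 0 and f(−1) + h(−1) = 0, and suppose B · sup_{w ∈ [−1,1]} |f'(w) + h'(w)| ≤ 1/2. Then for any real numbers v and v_e (e ∈ ι) with |v| ≤ 1 and |v_e| ≤ 1 for all e, one has |A·v + Σ_{e∈ι} A_e·v_e + B·(f(v) + h(v))| ≤ 1. -/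
/-- Discrete maximum principle for the finite volume scheme on a Schwarzschild
background: the convex-combination update with source term stays in `[-1, 1]`. -/
theorem stmt_9 (ι : Type*) [Fintype ι] (A B : ℝ) (Ae : ι → ℝ)
    (hAe : ∀ e, 0 ≤ Ae e) (hsum : A + ∑ e, Ae e = 1) (hA : 1 / 2 ≤ A) (hB : 0 ≤ B)
    (f h : ℝ → ℝ) (hf : ContDiff ℝ 1 f) (hh : ContDiff ℝ 1 h)
    (hH1 : f 1 + h 1 = 0) (hHm1 : f (-1) + h (-1) = 0)
    (hCFL : B * sSup ((fun w => |deriv f w + deriv h w|) '' Set.Icc (-1:ℝ) 1) ≤ 1 / 2)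
    (v : ℝ) (ve : ι → ℝ) (hv : |v| ≤ 1) (hve : ∀ e, |ve e| ≤ 1) :
    |A * v + ∑ e, Ae e * ve e + B * (f v + h v)| ≤ 1 := by
  set M := sSup ((fun w => |deriv f w + deriv h w|) '' Set.Icc (-1:ℝ) 1) with hM
  have hcont : Continuous (fun w => |deriv f w + deriv h w|) :=
    ((hf.continuous_deriv le_rfl).add (hh.continuous_deriv le_rfl)).abs
  have hbdd : BddAbove ((fun w => |deriv f w + deriv h w|) '' Set.Icc (-1:ℝ) 1) :=
    (isCompact_Icc.image hcont).bddAbove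
  have hder : ∀ w ∈ Set.Icc (-1:ℝ) 1,
      HasDerivWithinAt (fun x => f x + h x) (deriv f w + deriv h w) (Set.Icc (-1:ℝ) 1) w := by
    intro w _
    exact (((hf.differentiable (by norm_num)) w).hasDerivAt.add
      ((hh.differentiable (by norm_num)) w).hasDerivAt).hasDerivWithinAt
  have hbound : ∀ w ∈ Set.Icc (-1:ℝ) 1, ‖deriv f w + deriv h w‖ ≤ M := by
    intro w hw
    exact le_csSup hbdd ⟨w, hw, rfl⟩
  obtain ⟨hv1, hv2⟩ := abs_le.mp hv
  have hlip := fun x hx => (convex_Icc (-1:ℝ) 1).norm_image_sub_le_of_norm_hasDerivWithin_le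
    hder hbound (x := x) (y := v) hx ⟨hv1, hv2⟩
  have h1 := hlip 1 (by norm_num)
  have h2 := hlip (-1) (by norm_num)
  simp only [hH1, hHm1, sub_zero, Real.norm_eq_abs] at h1 h2
  rw [abs_sub_comm v 1, abs_of_nonneg (by linarith : (0:ℝ) ≤ 1 - v)] at h1
  rw [abs_of_nonneg (by linarith : (0:ℝ) ≤ v - -1)] at h2
  have e1 := mul_le_mul_of_nonneg_left (abs_le.mp h1).2 hB
  have e2 := mul_le_mul_of_nonneg_left (abs_le.mp h2).1 hB
  have c1 := mul_le_mul_of_nonneg_right hCFL (by linarith : (0:ℝ) ≤ 1 - v)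
  have c2 := mul_le_mul_of_nonneg_right hCFL (by linarith : (0:ℝ) ≤ v - -1)
  have d1 := mul_nonneg (sub_nonneg.mpr hA) (by linarith : (0:ℝ) ≤ 1 - v)
  have d2 := mul_nonneg (sub_nonneg.mpr hA) (by linarith : (0:ℝ) ≤ v - -1)
  have s1 : ∑ e, Ae e * ve e ≤ ∑ e, Ae e := Finset.sum_le_sum fun e _ =>
    mul_le_of_le_one_right (hAe e) (abs_le.mp (hve e)).2
  have s2 : -∑ e, Ae e ≤ ∑ e, Ae e * ve e := by
    rw [← Finset.sum_neg_distrib]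
    refine Finset.sum_le_sum fun e _ => ?_
    have := mul_le_mul_of_nonneg_left (abs_le.mp (hve e)).1 (hAe e)
    linarith
  rw [abs_le]
  constructor <;> nlinarith
end

section
/- Let M > 0 and let ρ, v : (0,∞) × (2M,∞) → ℝ be C¹ functions with ρ(t,r) > 0 and |v(t,r)| < 1 for all (t,r). Suppose that ρ and v satisfy the two balance equations: (i) ∂_t(ρ/(1 − v²)) + (1 − 2M/r)·∂_r(ρv/(1 − v²)) + ρ·v·(2r − 2M)/(r²(1 − v²)) = 0, and (ii) ∂_t(ρv/(1 − v²)) + (1 − 2M/r)·∂_r(ρv²/(1 − v²)) + ρ·(M(1 − 3v²) + 2v²r)/(r²(1 − v²)) = 0. Then v satisfies the relativistic Burgers equation ∂_t(v/(1 − 2M/r)²) + ∂_r((v²/2)/(1 − 2M/r)) + M/(r²(1 − 2M/r)²) = 0. -/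
/-- The pressureless Euler system in spherical symmetry on a Schwarzschild background
implies the relativistic Burgers equation for the normalized velocity `v`. -/
theorem stmt_12 (M : ℝ) (hM : 0 < M)
    (ρ v : ℝ × ℝ → ℝ)
    (hρ : ContDiffOn ℝ 1 ρ (Set.Ioi (0:ℝ) ×ˢ Set.Ioi (2 * M)))
    (hv : ContDiffOn ℝ 1 v (Set.Ioi (0:ℝ) ×ˢ Set.Ioi (2 * M)))
    (hρpos : ∀ p ∈ Set.Ioi (0:ℝ) ×ˢ Set.Ioi (2 * M), 0 < ρ p)
    (hvlt : ∀ p ∈ Set.Ioi (0:ℝ) ×ˢ Set.Ioi (2 * M), |v p| < 1)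
    (heq1 : ∀ t ∈ Set.Ioi (0:ℝ), ∀ r ∈ Set.Ioi (2 * M),
      deriv (fun τ => ρ (τ, r) / (1 - (v (τ, r)) ^ 2)) t
        + (1 - 2 * M / r) * deriv (fun s => ρ (t, s) * v (t, s) / (1 - (v (t, s)) ^ 2)) r
        + ρ (t, r) * v (t, r) * (2 * r - 2 * M) / (r ^ 2 * (1 - (v (t, r)) ^ 2)) = 0)
    (heq2 : ∀ t ∈ Set.Ioi (0:ℝ), ∀ r ∈ Set.Ioi (2 * M),
      deriv (fun τ => ρ (τ, r) * v (τ, r) / (1 - (v (τ, r)) ^ 2)) t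
        + (1 - 2 * M / r) *
            deriv (fun s => ρ (t, s) * (v (t, s)) ^ 2 / (1 - (v (t, s)) ^ 2)) r
        + ρ (t, r) * (M * (1 - 3 * (v (t, r)) ^ 2) + 2 * (v (t, r)) ^ 2 * r)
            / (r ^ 2 * (1 - (v (t, r)) ^ 2)) = 0) :
    ∀ t ∈ Set.Ioi (0:ℝ), ∀ r ∈ Set.Ioi (2 * M),
      deriv (fun τ => v (τ, r) / (1 - 2 * M / r) ^ 2) t
        + deriv (fun s => ((v (t, s)) ^ 2 / 2) / (1 - 2 * M / s)) r
        + M / (r ^ 2 * (1 - 2 * M / r) ^ 2) = 0 := by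
  intro t ht r hr
  have hmem : ((t, r) : ℝ × ℝ) ∈ Set.Ioi (0:ℝ) ×ˢ Set.Ioi (2 * M) := ⟨ht, hr⟩
  have hnhds : Set.Ioi (0:ℝ) ×ˢ Set.Ioi (2 * M) ∈ nhds ((t, r) : ℝ × ℝ) :=
    (isOpen_Ioi.prod isOpen_Ioi).mem_nhds hmem
  have dρ : DifferentiableAt ℝ ρ (t, r) := (hρ.contDiffAt hnhds).differentiableAt (by norm_num)
  have dv : DifferentiableAt ℝ v (t, r) := (hv.contDiffAt hnhds).differentiableAt (by norm_num)
  have hr' : 2 * M < r := hr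
  have hr0 : 0 < r := by linarith
  have hv1 : 0 < 1 - (v (t, r)) ^ 2 := by
    have := (sq_lt_one_iff_abs_lt_one (v (t, r))).2 (hvlt _ hmem)
    linarith
  have hw : 0 < ρ (t, r) / (1 - (v (t, r)) ^ 2) := div_pos (hρpos _ hmem) hv1
  have hf : 0 < 1 - 2 * M / r := by
    rw [sub_pos, div_lt_one hr0]; exact hr'
  have dt : DifferentiableAt ℝ (fun τ : ℝ => ((τ, r) : ℝ × ℝ)) t := by fun_prop
  have ds : DifferentiableAt ℝ (fun s : ℝ => ((t, s) : ℝ × ℝ)) r := by fun_prop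
  have dρt : DifferentiableAt ℝ (fun τ => ρ (τ, r)) t := DifferentiableAt.comp t dρ dt
  have dvt : DifferentiableAt ℝ (fun τ => v (τ, r)) t := DifferentiableAt.comp t dv dt
  have dρs : DifferentiableAt ℝ (fun s => ρ (t, s)) r := DifferentiableAt.comp r dρ ds
  have dvs : DifferentiableAt ℝ (fun s => v (t, s)) r := DifferentiableAt.comp r dv ds
  have hwt : DifferentiableAt ℝ (fun τ => ρ (τ, r) / (1 - (v (τ, r)) ^ 2)) t :=
    dρt.div ((dvt.pow 2).const_sub 1) hv1.ne'
  have hws : DifferentiableAt ℝ (fun s => ρ (t, s) / (1 - (v (t, s)) ^ 2)) r :=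
    dρs.div ((dvs.pow 2).const_sub 1) hv1.ne'
  have e1 := heq1 t ht r hr
  have e2 := heq2 t ht r hr
  have D1 : deriv (fun s => ρ (t, s) * v (t, s) / (1 - (v (t, s)) ^ 2)) r = _ :=
    ((hws.hasDerivAt.mul dvs.hasDerivAt).congr_of_eventuallyEq
      (Filter.Eventually.of_forall fun s => by simp only [Pi.mul_apply]; ring)).deriv
  have D2 : deriv (fun τ => ρ (τ, r) * v (τ, r) / (1 - (v (τ, r)) ^ 2)) t = _ :=
    ((hwt.hasDerivAt.mul dvt.hasDerivAt).congr_of_eventuallyEq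
      (Filter.Eventually.of_forall fun s => by simp only [Pi.mul_apply]; ring)).deriv
  have D3 : deriv (fun s => ρ (t, s) * (v (t, s)) ^ 2 / (1 - (v (t, s)) ^ 2)) r = _ :=
    ((hws.hasDerivAt.mul (dvs.hasDerivAt.mul dvs.hasDerivAt)).congr_of_eventuallyEq
      (Filter.Eventually.of_forall fun s => by simp only [Pi.mul_apply]; ring)).deriv
  have D4 : deriv (fun τ => v (τ, r) / (1 - 2 * M / r) ^ 2) t = _ :=
    (dvt.hasDerivAt.div_const _).deriv
  have Df : HasDerivAt (fun s : ℝ => 1 - 2 * M / s) (2 * M / r ^ 2) r := by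
    have := ((hasDerivAt_inv hr0.ne').const_mul (2 * M)).const_sub 1
    simpa [div_eq_mul_inv] using this
  have D5 : deriv (fun s => ((v (t, s)) ^ 2 / 2) / (1 - 2 * M / s)) r = _ :=
    (((dvs.hasDerivAt.pow 2).div_const 2).div Df hf.ne').deriv
  rw [D1] at e1
  rw [D2, D3] at e2
  rw [D4, D5]
  have s1 : ρ (t, r) * v (t, r) * (2 * r - 2 * M) / (r ^ 2 * (1 - (v (t, r)) ^ 2))
      = ρ (t, r) / (1 - (v (t, r)) ^ 2) * (v (t, r) * (2 * r - 2 * M) / r ^ 2) := by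
    field_simp
  have s2 : ρ (t, r) * (M * (1 - 3 * (v (t, r)) ^ 2) + 2 * (v (t, r)) ^ 2 * r)
            / (r ^ 2 * (1 - (v (t, r)) ^ 2))
      = ρ (t, r) / (1 - (v (t, r)) ^ 2) *
        ((M * (1 - 3 * (v (t, r)) ^ 2) + 2 * (v (t, r)) ^ 2 * r) / r ^ 2) := by
    field_simp
  rw [s1] at e1
  rw [s2] at e2
  simp only [Pi.mul_apply, Pi.pow_apply] at e1 e2 ⊢
  generalize deriv (fun τ => ρ (τ, r) / (1 - (v (τ, r)) ^ 2)) t = wt at *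
  generalize deriv (fun s => ρ (t, s) / (1 - (v (t, s)) ^ 2)) r = ws at *
  generalize deriv (fun τ => v (τ, r)) t = vt at *
  generalize deriv (fun s => v (t, s)) r = vs at *
  generalize ρ (t, r) / (1 - (v (t, r)) ^ 2) = w at *
  generalize v (t, r) = V at *
  have key : vt + (1 - 2 * M / r) * V * vs + M * (1 - V ^ 2) / r ^ 2 = 0 := by
    apply mul_left_cancel₀ hw.ne'
    linear_combination e2 - V * e1
  generalize hF : 1 - 2 * M / r = F at *
  have hF0 := hf.ne'
  have : vt = -(F * V * vs + M * (1 - V ^ 2) / r ^ 2) := by linarith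
  rw [this]
  field_simp
  ring
end
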